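/- arXiv:1411.6824 — 2 statements merged into one kernel-verified Lean document; each statement's English description precedes it below -/
import Mathlib

section
/- Let X^{(n)} be an intensity-1 Poisson point process on the torus T_n with i.i.d. marks R satisfying lim_{h→∞} h^d P(R>h) = β (tail index s = d). Then there is a constant c_1 > 0 such that with probability tending to 1 as n → ∞, X^{(n)} contains no toroidal descending chain with more than c_1 log n elements. -/
open MeasureTheory Filter
open scoped ENNReal Topology

/-- Toroidal distance on the torus of side length `n`, represented on `[-n/2,n/2]^d`. -/
noncomputable def torDist (d : ℕ) (n : ℝ) (x y : EuclideanSpace ℝ (Fin d)) : ℝ :=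
  Real.sqrt (∑ i, (min |x i - y i| (n - |x i - y i|)) ^ 2)

/-- The representative cube `[-n/2, n/2]^d` of the torus `T_n`. -/
def torCube (d : ℕ) (n : ℝ) : Set (EuclideanSpace ℝ (Fin d)) :=
  {ξ | ∀ i, |ξ i| ≤ n / 2}

/-- `f` is a toroidal descending chain: strictly decreasing marks, and each point lies
within the radius of influence of its predecessor (in toroidal distance). -/
noncomputable def isDescChain (d : ℕ) (n : ℝ) {m : ℕ}
    (f : Fin m → EuclideanSpace ℝ (Fin d) × ℝ) : Prop :=
  (∀ i j : Fin m, i < j → (f j).2 < (f i).2) ∧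
  ∀ (i : ℕ) (h : i + 1 < m),
    torDist d n (f ⟨i, Nat.lt_of_succ_lt h⟩).1 (f ⟨i + 1, h⟩).1 ≤ (f ⟨i, Nat.lt_of_succ_lt h⟩).2

/-! ### Iterated ordered integrals -/

/-- Iterated integrals of `w` over decreasing sequences below `r`. -/
noncomputable def ordInt (μ : Measure ℝ) (w : ℝ → ℝ≥0∞) : ℕ → ℝ → ℝ≥0∞
  | 0, _ => 1
  | k + 1, r => ∫⁻ s in Set.Iio r, w s * ordInt μ w k s ∂μ

lemma ordInt_mono (μ : Measure ℝ) (w : ℝ → ℝ≥0∞) (k : ℕ) : Monotone (ordInt μ w k) := by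
  cases k with
  | zero => intro a b _; simp [ordInt]
  | succ k =>
    intro a b hab
    simp only [ordInt]
    exact lintegral_mono_set (Set.Iio_subset_Iio hab)

lemma ordInt_measurable (μ : Measure ℝ) (w : ℝ → ℝ≥0∞) (k : ℕ) : Measurable (ordInt μ w k) :=
  (ordInt_mono μ w k).measurable

lemma ordInt_swap (μ : Measure ℝ) [SFinite μ] (w f : ℝ → ℝ≥0∞) (hw : Measurable w)
    (hf : Measurable f) (r : ℝ) :
    ∫⁻ s in Set.Iio r, (w s * f s) * (∫⁻ t in Set.Ioo s r, w t ∂μ) ∂μ =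
      ∫⁻ t in Set.Iio r, w t * (∫⁻ s in Set.Iio t, w s * f s ∂μ) ∂μ := by
  have hm : Measurable (fun p : ℝ × ℝ => (Set.indicator {p : ℝ × ℝ | p.1 < p.2 ∧ p.2 < r}
      (fun p => w p.1 * f p.1 * w p.2)) p) := by
    apply Measurable.indicator (by fun_prop)
    exact (measurableSet_lt measurable_fst measurable_snd).inter
      (measurableSet_lt measurable_snd measurable_const)
  have key := lintegral_lintegral_swap (μ := μ) (ν := μ)
    (f := fun s t => (Set.indicator {p : ℝ × ℝ | p.1 < p.2 ∧ p.2 < r}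
      (fun p => w p.1 * f p.1 * w p.2)) (s, t)) hm.aemeasurable
  have h1 : ∫⁻ s in Set.Iio r, (w s * f s) * (∫⁻ t in Set.Ioo s r, w t ∂μ) ∂μ =
      ∫⁻ s, ∫⁻ t, (Set.indicator {p : ℝ × ℝ | p.1 < p.2 ∧ p.2 < r}
      (fun p => w p.1 * f p.1 * w p.2)) (s, t) ∂μ ∂μ := by
    rw [← lintegral_indicator measurableSet_Iio]
    apply lintegral_congr
    intro s
    by_cases hs : s < r
    · rw [Set.indicator_of_mem (by exact hs), ← lintegral_const_mul _ hw,
        ← lintegral_indicator measurableSet_Ioo]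
      apply lintegral_congr
      intro t
      simp [Set.indicator]
    · rw [Set.indicator_of_notMem (by exact hs)]
      symm
      rw [lintegral_eq_zero_iff' (by fun_prop)]
      refine Eventually.of_forall fun t => ?_
      apply Set.indicator_of_notMem
      rintro ⟨h1, h2⟩
      exact hs (lt_trans h1 h2)
  have h2 : ∫⁻ t in Set.Iio r, w t * (∫⁻ s in Set.Iio t, w s * f s ∂μ) ∂μ =
      ∫⁻ t, ∫⁻ s, (Set.indicator {p : ℝ × ℝ | p.1 < p.2 ∧ p.2 < r}
      (fun p => w p.1 * f p.1 * w p.2)) (s, t) ∂μ ∂μ := by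
    rw [← lintegral_indicator measurableSet_Iio]
    apply lintegral_congr
    intro t
    by_cases ht : t < r
    · rw [Set.indicator_of_mem (by exact ht), ← lintegral_const_mul _ (by fun_prop),
        ← lintegral_indicator measurableSet_Iio]
      apply lintegral_congr
      intro s
      simp [Set.indicator, ht, mul_comm]
    · rw [Set.indicator_of_notMem (by exact ht)]
      symm
      rw [lintegral_eq_zero_iff' (by fun_prop)]
      refine Eventually.of_forall fun s => ?_
      apply Set.indicator_of_notMem
      rintro ⟨h1, h2⟩
      exact ht h2
  rw [h1, h2, key]

lemma ordInt_succ_le (μ : Measure ℝ) [SFinite μ] (w : ℝ → ℝ≥0∞) (hw : Measurable w) (k : ℕ) :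
    ∀ r, ((k + 1 : ℕ) : ℝ≥0∞) * ordInt μ w (k + 1) r ≤
      (∫⁻ s in Set.Iio r, w s ∂μ) * ordInt μ w k r := by
  induction k with
  | zero => intro r; simp [ordInt]
  | succ k ih =>
    intro r
    have hc := ordInt_measurable μ w
    have hΛ : Measurable fun s => ∫⁻ t in Set.Iio s, w t ∂μ := by
      apply Monotone.measurable
      intro a b hab
      exact lintegral_mono_set (Set.Iio_subset_Iio hab)
    have e1 : (∫⁻ s in Set.Iio r, w s ∂μ) * ordInt μ w (k + 1) r =
        ∫⁻ s in Set.Iio r, (w s * ordInt μ w k s) * (∫⁻ t in Set.Iio r, w t ∂μ) ∂μ := by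
      rw [lintegral_mul_const _ (by fun_prop), mul_comm]; rfl
    have e2 : ∫⁻ s in Set.Iio r, ((w s * ordInt μ w k s) * (∫⁻ t in Set.Iio s, w t ∂μ) +
        (w s * ordInt μ w k s) * (∫⁻ t in Set.Ioo s r, w t ∂μ)) ∂μ ≤
        ∫⁻ s in Set.Iio r, (w s * ordInt μ w k s) * (∫⁻ t in Set.Iio r, w t ∂μ) ∂μ := by
      apply setLIntegral_mono' measurableSet_Iio
      intro s hs
      rw [← mul_add]
      gcongr
      rw [← lintegral_union measurableSet_Ioo]
      · apply lintegral_mono_set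
        rintro t (ht | ht)
        · exact lt_trans (Set.mem_Iio.1 ht) (Set.mem_Iio.1 hs)
        · exact ht.2
      · rw [Set.disjoint_left]
        intro t ht ht'
        exact lt_asymm ht ht'.1
    have e3 : ((k + 1 : ℕ) : ℝ≥0∞) * ordInt μ w (k + 2) r ≤
        ∫⁻ s in Set.Iio r, (w s * ordInt μ w k s) * (∫⁻ t in Set.Iio s, w t ∂μ) ∂μ := by
      rw [show ordInt μ w (k + 2) r = ∫⁻ s in Set.Iio r, w s * ordInt μ w (k + 1) s ∂μ from rfl,
        ← lintegral_const_mul _ (by fun_prop)]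
      apply lintegral_mono
      intro s
      calc ((k + 1 : ℕ) : ℝ≥0∞) * (w s * ordInt μ w (k + 1) s)
          = w s * (((k + 1 : ℕ) : ℝ≥0∞) * ordInt μ w (k + 1) s) := by ring
        _ ≤ w s * ((∫⁻ t in Set.Iio s, w t ∂μ) * ordInt μ w k s) := by
            exact mul_le_mul_right (ih s) _
        _ = _ := by ring
    rw [e1]
    refine le_trans ?_ e2
    rw [lintegral_add_left (by fun_prop), ordInt_swap μ w _ hw (hc k)]
    calc ((k + 1 + 1 : ℕ) : ℝ≥0∞) * ordInt μ w (k + 2) r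
        = ((k + 1 : ℕ) : ℝ≥0∞) * ordInt μ w (k + 2) r + ordInt μ w (k + 2) r := by
          push_cast; ring
      _ ≤ _ := add_le_add e3 le_rfl

lemma ordInt_factorial_le (μ : Measure ℝ) [SFinite μ] (w : ℝ → ℝ≥0∞) (hw : Measurable w) (k : ℕ)
    (r : ℝ) : (k.factorial : ℝ≥0∞) * ordInt μ w k r ≤ (∫⁻ s, w s ∂μ) ^ k := by
  induction k with
  | zero => simp [ordInt]
  | succ k ih =>
    rw [Nat.factorial_succ, Nat.cast_mul]
    calc ((k + 1 : ℕ) : ℝ≥0∞) * (k.factorial : ℝ≥0∞) * ordInt μ w (k + 1) r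
        = (k.factorial : ℝ≥0∞) * (((k + 1 : ℕ) : ℝ≥0∞) * ordInt μ w (k + 1) r) := by ring
      _ ≤ (k.factorial : ℝ≥0∞) * ((∫⁻ s in Set.Iio r, w s ∂μ) * ordInt μ w k r) := by
          exact mul_le_mul_right (ordInt_succ_le μ w hw k r) _
      _ = (∫⁻ s in Set.Iio r, w s ∂μ) * ((k.factorial : ℝ≥0∞) * ordInt μ w k r) := by ring
      _ ≤ (∫⁻ s, w s ∂μ) * (∫⁻ s, w s ∂μ) ^ k := by
          exact mul_le_mul' (setLIntegral_le_lintegral _ _) ih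
      _ = _ := by ring

/-! ### Volumes -/

lemma volume_box (d : ℕ) (s : Fin d → Set ℝ) (hs : ∀ i, MeasurableSet (s i)) :
    volume {y : EuclideanSpace ℝ (Fin d) | ∀ i, y i ∈ s i} = ∏ i, volume (s i) := by
  have h := (EuclideanSpace.volume_preserving_symm_measurableEquiv_toLp (Fin d))
  rw [← volume_pi_pi, ← h.measure_preimage (MeasurableSet.univ_pi hs).nullMeasurableSet]
  congr 1
  ext y
  simp

lemma torCube_eq (d : ℕ) (n : ℝ) :
    torCube d n = {y | ∀ i, y i ∈ Set.Icc (-(n/2)) (n/2)} := by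
  ext y; simp only [torCube, abs_le, Set.mem_ofPred_eq, Set.mem_Icc]

lemma torCube_measurable (d : ℕ) (n : ℝ) : MeasurableSet (torCube d n) := by
  have : torCube d n = ⋂ i, {y | |y i| ≤ n / 2} := by ext; simp [torCube]
  rw [this]
  refine MeasurableSet.iInter fun i => ?_
  exact measurableSet_le (by fun_prop) measurable_const

lemma volume_torCube (d : ℕ) (n : ℝ) : volume (torCube d n) = ENNReal.ofReal n ^ d := by
  rw [torCube_eq, volume_box d _ (fun _ => measurableSet_Icc)]
  simp

/-- Upper bound for the volume of a toroidal ball. -/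
noncomputable def wt (d : ℕ) (n r : ℝ) : ℝ≥0∞ := (ENNReal.ofReal (min (6 * r) n)) ^ d

lemma wt_measurable (d : ℕ) (n : ℝ) : Measurable (wt d n) := by
  unfold wt; fun_prop

lemma volume_torBall (d : ℕ) (hd : 2 ≤ d) (n r : ℝ) (x : EuclideanSpace ℝ (Fin d))
    (hx : x ∈ torCube d n) :
    volume ({y | torDist d n x y ≤ r} ∩ torCube d n) ≤ wt d n r := by
  rcases lt_or_ge r 0 with hr | hr
  · have : {y | torDist d n x y ≤ r} ∩ torCube d n = ∅ := by
      ext y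
      simp only [Set.mem_inter_iff, Set.mem_ofPred_eq, Set.mem_empty_iff_false, iff_false, not_and]
      intro h
      exact absurd (le_trans (Real.sqrt_nonneg _) h) (not_le.2 hr)
    rw [this]; simp
  rcases le_total (6 * r) n with h6 | h6
  · rw [wt, min_eq_left h6]
    let s : Fin d → Set ℝ := fun i => Set.Icc (x i - r) (x i + r) ∪
      (Set.Icc (x i + n - r) (x i + n + r) ∪ Set.Icc (x i - n - r) (x i - n + r))
    have hsub : {y | torDist d n x y ≤ r} ∩ torCube d n ⊆ {y | ∀ i, y i ∈ s i} := by
      rintro y ⟨hy, hyc⟩ i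
      have hmin : min |x i - y i| (n - |x i - y i|) ≤ r := by
        have h1 : (min |x i - y i| (n - |x i - y i|)) ^ 2 ≤
            ∑ i, (min |x i - y i| (n - |x i - y i|)) ^ 2 :=
          Finset.single_le_sum (f := fun i => (min |x i - y i| (n - |x i - y i|)) ^ 2)
            (fun _ _ => sq_nonneg _) (Finset.mem_univ i)
        calc _ ≤ |min |x i - y i| (n - |x i - y i|)| := le_abs_self _
          _ ≤ torDist d n x y := Real.abs_le_sqrt h1
          _ ≤ r := hy
      have h1 := abs_le.1 (hx i)
      have h2 := abs_le.1 (hyc i)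
      simp only [s, Set.mem_union, Set.mem_Icc]
      rcases min_le_iff.1 hmin with h | h
      · left
        have := abs_le.1 h
        constructor <;> linarith
      · right
        rcases abs_cases (x i - y i) with ⟨h3, _⟩ | ⟨h3, _⟩
        · right; rw [h3] at h; constructor <;> linarith
        · left; rw [h3] at h; constructor <;> linarith
    refine (measure_mono hsub).trans ?_
    rw [volume_box d s (fun i => by measurability)]
    calc ∏ i, volume (s i) ≤ ∏ _i : Fin d, ENNReal.ofReal (6 * r) := by
          apply Finset.prod_le_prod' 
          intro i _
          refine (measure_union_le _ _).trans ?_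
          refine (add_le_add le_rfl (measure_union_le _ _)).trans ?_
          simp only [Real.volume_Icc]
          rw [← ENNReal.ofReal_add (by linarith) (by linarith),
            ← ENNReal.ofReal_add (by linarith) (by linarith)]
          apply ENNReal.ofReal_le_ofReal
          linarith
      _ = _ := by simp
  · rw [wt, min_eq_right h6, ← volume_torCube]
    exact measure_mono Set.inter_subset_right

/-! ### Measure of chains -/

lemma torDist_measurable (d : ℕ) (n : ℝ) {α : Type*} [MeasurableSpace α]
    {f g : α → EuclideanSpace ℝ (Fin d)} (hf : Measurable f) (hg : Measurable g) :
    Measurable fun a => torDist d n (f a) (g a) := by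
  unfold torDist
  refine Measurable.sqrt ?_
  refine Finset.measurable_sum _ fun i _ => ?_
  have h1 : Measurable fun a => f a i := by fun_prop
  have h2 : Measurable fun a => g a i := by fun_prop
  have h3 : Measurable fun a => |f a i - g a i| := by fun_prop
  exact (h3.min (measurable_const.sub h3)).pow_const 2

lemma isDescChain_measurable (d : ℕ) (n : ℝ) (m : ℕ) :
    MeasurableSet {f : Fin m → EuclideanSpace ℝ (Fin d) × ℝ | isDescChain d n f} := by
  have h1 : MeasurableSet (⋂ (i : Fin m) (j : Fin m) (_ : i < j),
      {f : Fin m → EuclideanSpace ℝ (Fin d) × ℝ | (f j).2 < (f i).2}) := by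
    refine MeasurableSet.iInter fun i => MeasurableSet.iInter fun j => MeasurableSet.iInter fun _ => ?_
    exact measurableSet_lt (by fun_prop) (by fun_prop)
  have h2 : MeasurableSet (⋂ (i : ℕ) (h : i + 1 < m),
      {f : Fin m → EuclideanSpace ℝ (Fin d) × ℝ |
        torDist d n (f ⟨i, Nat.lt_of_succ_lt h⟩).1 (f ⟨i + 1, h⟩).1 ≤
          (f ⟨i, Nat.lt_of_succ_lt h⟩).2}) := by
    refine MeasurableSet.iInter fun i => MeasurableSet.iInter fun h => ?_
    exact measurableSet_le (torDist_measurable d n (by fun_prop) (by fun_prop)) (by fun_prop)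
  convert h1.inter h2 using 1
  ext f
  simp only [isDescChain, Set.mem_ofPred_eq, Set.mem_inter_iff, Set.mem_iInter]

lemma pi_cons {α : Type*} [MeasurableSpace α] (ν : Measure α) [SigmaFinite ν] (m : ℕ)
    (S : Set (Fin (m + 1) → α)) (hS : MeasurableSet S) :
    (Measure.pi fun _ : Fin (m + 1) => ν) S =
      ∫⁻ p, (Measure.pi fun _ : Fin m => ν) {g | (Fin.cons p g : Fin (m + 1) → α) ∈ S} ∂ν := by
  have h := (measurePreserving_piFinSuccAbove (fun _ : Fin (m + 1) => ν) 0).symm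
  rw [← h.measure_preimage hS.nullMeasurableSet, Measure.prod_apply (h.measurable hS)]
  apply lintegral_congr
  intro p
  congr 1
  ext g
  simp [MeasurableEquiv.piFinSuccAbove, Fin.insertNthEquiv]

lemma isDescChain_tail {d : ℕ} {n : ℝ} {m : ℕ} {p : EuclideanSpace ℝ (Fin d) × ℝ}
    {f : Fin (m + 1) → EuclideanSpace ℝ (Fin d) × ℝ}
    (h : isDescChain d n (Fin.cons p f : Fin (m + 2) → EuclideanSpace ℝ (Fin d) × ℝ)) :
    (f 0).2 < p.2 ∧ torDist d n p.1 (f 0).1 ≤ p.2 ∧ isDescChain d n f := by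
  obtain ⟨h1, h2⟩ := h
  refine ⟨?_, ?_, ?_, ?_⟩
  · have := h1 0 (Fin.succ 0) (Fin.succ_pos 0)
    rwa [Fin.cons_succ, Fin.cons_zero] at this
  · have := h2 0 (by omega)
    change torDist d n p.1 (f 0).1 ≤ p.2 at this
    exact this
  · intro i j hij
    have := h1 i.succ j.succ (Fin.succ_lt_succ_iff.2 hij)
    rwa [Fin.cons_succ, Fin.cons_succ] at this
  · intro i hi
    exact h2 (i + 1) (by omega)

lemma isDescChain_init {d : ℕ} {n : ℝ} {m m' : ℕ} (hm : m' ≤ m)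
    {f : Fin m → EuclideanSpace ℝ (Fin d) × ℝ} (h : isDescChain d n f) :
    isDescChain d n (fun i : Fin m' => f (Fin.castLE hm i)) := by
  obtain ⟨h1, h2⟩ := h
  refine ⟨fun i j hij => h1 _ _ (by simpa using hij), fun i hi => h2 i (by omega)⟩

section
variable (d : ℕ) (n : ℝ) (μR : Measure ℝ)

/-- The intensity measure. -/
noncomputable def nuM : Measure (EuclideanSpace ℝ (Fin d) × ℝ) :=
  ((volume : Measure (EuclideanSpace ℝ (Fin d))).restrict (torCube d n)).prod μR

instance [IsProbabilityMeasure μR] : SigmaFinite (nuM d n μR) := by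
  unfold nuM; infer_instance

/-- Continuations of a chain from `p`. -/
def contSet (m : ℕ) (p : EuclideanSpace ℝ (Fin d) × ℝ) :
    Set (Fin m → EuclideanSpace ℝ (Fin d) × ℝ) :=
  {g | isDescChain d n (Fin.cons p g : Fin (m + 1) → EuclideanSpace ℝ (Fin d) × ℝ)}

lemma contSet_measurable (m : ℕ) (p : EuclideanSpace ℝ (Fin d) × ℝ) :
    MeasurableSet (contSet d n m p) := by
  have : Measurable fun g : Fin m → EuclideanSpace ℝ (Fin d) × ℝ =>
      (Fin.cons p g : Fin (m + 1) → EuclideanSpace ℝ (Fin d) × ℝ) := by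
    rw [measurable_pi_iff]
    intro i
    refine Fin.cases ?_ (fun j => ?_) i
    · simp
    · simpa using measurable_pi_apply j
  exact this (isDescChain_measurable d n (m + 1))

lemma contSet_step [IsProbabilityMeasure μR] (m : ℕ) (p : EuclideanSpace ℝ (Fin d) × ℝ)
    (b : ℝ → ℝ≥0∞) (hd : 2 ≤ d) (hp : p.1 ∈ torCube d n) (hb : Measurable b)
    (H : ∀ q : EuclideanSpace ℝ (Fin d) × ℝ, q.1 ∈ torCube d n →
      (Measure.pi fun _ : Fin m => nuM d n μR) (contSet d n m q) ≤ b q.2) :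
    (Measure.pi fun _ : Fin (m + 1) => nuM d n μR) (contSet d n (m + 1) p) ≤
      wt d n p.2 * ∫⁻ s in Set.Iio p.2, b s ∂μR := by
  rw [pi_cons _ _ _ (contSet_measurable d n (m + 1) p)]
  have hball : MeasurableSet {y : EuclideanSpace ℝ (Fin d) | torDist d n p.1 y ≤ p.2} :=
    measurableSet_le (torDist_measurable d n measurable_const measurable_id) measurable_const
  calc _ ≤ ∫⁻ q, ({y | torDist d n p.1 y ≤ p.2} ∩ torCube d n).indicator 1 q.1 *
        (Set.Iio p.2).indicator b q.2 ∂(nuM d n μR) := by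
        have hae : ∀ᵐ q ∂(nuM d n μR), q.1 ∈ torCube d n := by
          have h := ae_restrict_mem (μ := volume) (torCube_measurable d n)
          exact Measure.quasiMeasurePreserving_fst.ae h
        apply lintegral_mono_ae
        filter_upwards [hae] with q hq
        by_cases h : q.2 < p.2 ∧ torDist d n p.1 q.1 ≤ p.2
        · rw [Set.indicator_of_mem (by exact ⟨h.2, hq⟩), Set.indicator_of_mem (by exact h.1)]
          simp only [Pi.one_apply, one_mul]
          refine le_trans (measure_mono ?_) (H q hq)
          intro g hg
          exact (isDescChain_tail hg).2.2
        · have : {g | (Fin.cons q g : Fin (m + 1) → EuclideanSpace ℝ (Fin d) × ℝ) ∈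
              contSet d n (m + 1) p} = ∅ := by
            ext g
            simp only [Set.mem_ofPred_eq, Set.mem_empty_iff_false, iff_false]
            intro hg
            have := isDescChain_tail hg
            exact h ⟨by simpa using this.1, by simpa using this.2.1⟩
          rw [this]; simp
    _ = (∫⁻ y in torCube d n, ({y | torDist d n p.1 y ≤ p.2} ∩ torCube d n).indicator 1 y) *
        ∫⁻ s, (Set.Iio p.2).indicator b s ∂μR := by
        unfold nuM
        rw [lintegral_prod_mul]
        · exact (measurable_one.indicator (hball.inter (torCube_measurable d n))).aemeasurable
        · exact (hb.indicator measurableSet_Iio).aemeasurable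
    _ ≤ _ := by
        rw [lintegral_indicator measurableSet_Iio]
        gcongr
        refine (setLIntegral_le_lintegral _ _).trans ?_
        rw [lintegral_indicator_one (hball.inter (torCube_measurable d n))]
        exact volume_torBall d hd n p.2 p.1 hp

lemma contSet_le [IsProbabilityMeasure μR] (hd : 2 ≤ d) (m : ℕ) :
    ∀ p : EuclideanSpace ℝ (Fin d) × ℝ, p.1 ∈ torCube d n →
    (Measure.pi fun _ : Fin (m + 1) => nuM d n μR) (contSet d n (m + 1) p) ≤
      wt d n p.2 * ordInt μR (wt d n) m p.2 := by
  induction m with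
  | zero =>
    intro p hp
    refine (contSet_step d n μR 0 p (fun _ => 1) hd hp measurable_const ?_).trans ?_
    · intro q _
      refine (measure_mono (Set.subset_univ _)).trans ?_
      simp
    · simp only [ordInt]
      gcongr
      simp [prob_le_one]
  | succ m ih =>
    intro p hp
    exact contSet_step d n μR (m + 1) p (fun s => wt d n s * ordInt μR (wt d n) m s) hd hp
      ((wt_measurable d n).mul (ordInt_measurable _ _ _)) ih

lemma chain_measure_le [IsProbabilityMeasure μR] (hd : 2 ≤ d) (k : ℕ) (Λ : ℝ≥0∞)
    (hΛ : ∫⁻ s, wt d n s ∂μR ≤ Λ) :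
    (Measure.pi fun _ : Fin (k + 2) => nuM d n μR) {f | isDescChain d n f} ≤
      ENNReal.ofReal n ^ d * (Λ * (Λ ^ k / k.factorial)) := by
  rw [pi_cons _ _ _ (isDescChain_measurable d n _)]
  have hae : ∀ᵐ q ∂(nuM d n μR), q.1 ∈ torCube d n := by
    have h := ae_restrict_mem (μ := volume) (torCube_measurable d n)
    exact Measure.quasiMeasurePreserving_fst.ae h
  calc _ ≤ ∫⁻ q, 1 * (wt d n q.2 * (Λ ^ k / k.factorial)) ∂(nuM d n μR) := by
        apply lintegral_mono_ae
        filter_upwards [hae] with q hq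
        refine (contSet_le d n μR hd k q hq).trans ?_
        rw [one_mul]
        gcongr
        rw [ENNReal.le_div_iff_mul_le (Or.inl (by exact_mod_cast k.factorial_ne_zero))
          (Or.inl (by simp)), mul_comm]
        refine (ordInt_factorial_le μR _ (wt_measurable d n) k q.2).trans ?_
        gcongr
    _ = (∫⁻ _ in torCube d n, 1) * ∫⁻ s, wt d n s * (Λ ^ k / k.factorial) ∂μR := by
        unfold nuM
        rw [lintegral_prod_mul (f := fun _ => (1 : ℝ≥0∞))
          (g := fun s => wt d n s * (Λ ^ k / k.factorial))]
        · exact measurable_const.aemeasurable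
        · exact ((wt_measurable d n).mul_const _).aemeasurable
    _ ≤ _ := by
        rw [lintegral_mul_const _ (wt_measurable d n)]
        simp only [lintegral_const, one_mul, Measure.restrict_apply_univ, volume_torCube]
        gcongr

end

/-! ### The truncated moment -/

lemma tail_bound {d : ℕ} {β : ℝ} (μR : Measure ℝ) [IsProbabilityMeasure μR]
    (htail : Tendsto (fun h : ℝ => h ^ d * (μR (Set.Ioi h)).toReal) atTop (𝓝 β)) :
    ∃ B : ℝ, 0 < B ∧ ∀ h : ℝ, 0 < h → ENNReal.ofReal h ^ d * μR (Set.Ioi h) ≤ ENNReal.ofReal B := by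
  obtain ⟨h0, hh0⟩ := eventually_atTop.1 (htail.eventually_le_const (lt_add_one β))
  refine ⟨max (β + 1) (max h0 1 ^ d), lt_max_of_lt_right (by positivity), fun h hh => ?_⟩
  have : ENNReal.ofReal h ^ d * μR (Set.Ioi h) =
      ENNReal.ofReal (h ^ d * (μR (Set.Ioi h)).toReal) := by
    rw [ENNReal.ofReal_mul (by positivity), ENNReal.ofReal_pow hh.le,
      ENNReal.ofReal_toReal (measure_ne_top _ _)]
  rw [this]
  apply ENNReal.ofReal_le_ofReal
  rcases le_total h0 h with h1 | h1
  · exact le_max_of_le_left (hh0 h h1)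
  · apply le_max_of_le_right
    have h2 : (μR (Set.Ioi h)).toReal ≤ 1 := measureReal_le_one
    calc _ ≤ h ^ d * 1 := by gcongr
      _ = h ^ d := mul_one _
      _ ≤ _ := by gcongr; exact le_max_of_le_left h1

lemma dyadic_bound (d : ℕ) (r : ℝ) (J : ℕ) :
    ENNReal.ofReal (min r (2 ^ J)) ^ d ≤
      1 + ∑ j ∈ Finset.range J,
        (Set.Ioi ((2 : ℝ) ^ j)).indicator (fun _ => ENNReal.ofReal (2 ^ (j + 1)) ^ d) r := by
  induction J with
  | zero =>
    simp only [pow_zero, Finset.range_zero, Finset.sum_empty, add_zero]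
    apply pow_le_one₀ (zero_le)
    rw [← ENNReal.ofReal_one]
    exact ENNReal.ofReal_le_ofReal (min_le_right _ _)
  | succ J ih =>
    rw [Finset.sum_range_succ, ← add_assoc]
    by_cases h : (2 : ℝ) ^ J < r
    · rw [Set.indicator_of_mem (a := r) (s := Set.Ioi ((2 : ℝ) ^ J)) h]
      refine le_trans ?_ le_add_self
      gcongr
      exact min_le_right _ _
    · refine le_trans ?_ (ih.trans le_self_add)
      refine pow_le_pow_left' (ENNReal.ofReal_le_ofReal ?_) d
      exact le_min (min_le_left _ _) ((min_le_left _ _).trans (not_lt.1 h))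

lemma moment_bound {d : ℕ} {β : ℝ} (μR : Measure ℝ) [IsProbabilityMeasure μR]
    (htail : Tendsto (fun h : ℝ => h ^ d * (μR (Set.Ioi h)).toReal) atTop (𝓝 β)) :
    ∃ K : ℝ, 0 < K ∧ ∀ (n : ℝ) (L : ℕ), 1 ≤ L → 0 ≤ n → n ≤ 2 ^ L →
      ∫⁻ s, wt d n s ∂μR ≤ ENNReal.ofReal (K * L) := by
  obtain ⟨B, hB, hB'⟩ := tail_bound μR htail
  refine ⟨6 ^ d * (1 + 2 ^ d * B), by positivity, fun n L hL hn hnL => ?_⟩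
  have h1 : ∀ s, wt d n s ≤ 6 ^ d * (1 + ∑ j ∈ Finset.range L,
      (Set.Ioi ((2 : ℝ) ^ j)).indicator (fun _ => ENNReal.ofReal (2 ^ (j + 1)) ^ d) s) := by
    intro s
    refine le_trans ?_ (mul_le_mul_right (dyadic_bound d s L) _)
    rw [← mul_pow, wt]
    gcongr
    rw [show (6 : ℝ≥0∞) = ENNReal.ofReal 6 by simp, ← ENNReal.ofReal_mul (by norm_num)]
    apply ENNReal.ofReal_le_ofReal
    rw [mul_min_of_nonneg _ _ (by norm_num)]
    exact min_le_min le_rfl (by linarith)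
  refine (lintegral_mono h1).trans ?_
  have hm : ∀ j : ℕ, Measurable fun s : ℝ => (Set.Ioi ((2 : ℝ) ^ j)).indicator
      (fun _ => ENNReal.ofReal (2 ^ (j + 1)) ^ d) s :=
    fun j => measurable_const.indicator measurableSet_Ioi
  have hm' : Measurable fun s : ℝ => 1 + ∑ j ∈ Finset.range L, (Set.Ioi ((2 : ℝ) ^ j)).indicator
      (fun _ => ENNReal.ofReal (2 ^ (j + 1)) ^ d) s :=
    measurable_const.add (Finset.measurable_sum _ fun j _ => hm j)
  rw [lintegral_const_mul _ hm',
    lintegral_add_left measurable_const, lintegral_finsetSum _ fun j _ => hm j]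
  have h2 : ∀ j ∈ Finset.range L, ∫⁻ s, (Set.Ioi ((2 : ℝ) ^ j)).indicator
      (fun _ => ENNReal.ofReal (2 ^ (j + 1)) ^ d) s ∂μR ≤ ENNReal.ofReal (2 ^ d * B) := by
    intro j _
    rw [lintegral_indicator measurableSet_Ioi, setLIntegral_const, pow_succ',
      ENNReal.ofReal_mul (by norm_num), mul_pow, mul_assoc, ENNReal.ofReal_mul (by positivity),
      ENNReal.ofReal_pow (by norm_num : (0:ℝ) ≤ 2) d]
    gcongr
    exact hB' _ (by positivity)
  calc _ ≤ (6 : ℝ≥0∞) ^ d * (1 + ∑ j ∈ Finset.range L, ENNReal.ofReal (2 ^ d * B)) := by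
        gcongr with j hj
        · simp
        · exact h2 j hj
    _ = ENNReal.ofReal (6 ^ d * (1 + L * (2 ^ d * B))) := by
        rw [ENNReal.ofReal_mul (by positivity : (0:ℝ) ≤ 6 ^ d),
          ENNReal.ofReal_add (by positivity) (by positivity),
          ENNReal.ofReal_mul (by positivity : (0:ℝ) ≤ L), ENNReal.ofReal_pow (by norm_num)]
        simp
    _ ≤ _ := by
        apply ENNReal.ofReal_le_ofReal
        have : (1 : ℝ) ≤ L := by exact_mod_cast hL
        rw [mul_assoc]
        gcongr
        nlinarith [this]

lemma final_bound (d : ℕ) (K : ℝ) (hK : 0 < K) :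
    ∃ A : ℕ, ∀ (n : ℝ) (L : ℕ), 0 ≤ n → n ≤ 2 ^ L →
      ENNReal.ofReal n ^ d * (ENNReal.ofReal (K * L) *
        (ENNReal.ofReal (K * L) ^ (A * L) / ((A * L).factorial))) ≤
      ENNReal.ofReal (K * (1 / 2) ^ L) := by
  obtain ⟨A, hA⟩ := pow_unbounded_of_one_lt (2 ^ (d + 2) * Real.exp (2 * K))
    (by norm_num : (1 : ℝ) < 2)
  refine ⟨A, fun n L hn hnL => ?_⟩
  have hf : (0 : ℝ) < ((A * L).factorial : ℝ) := by positivity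
  rw [← ENNReal.ofReal_pow (by positivity), ← ENNReal.ofReal_pow (by positivity),
    ← ENNReal.ofReal_natCast, ← ENNReal.ofReal_div_of_pos hf,
    ← ENNReal.ofReal_mul (by positivity), ← ENNReal.ofReal_mul (by positivity)]
  apply ENNReal.ofReal_le_ofReal
  have h1 : (2 * (K * L)) ^ (A * L) / ((A * L).factorial : ℝ) ≤ Real.exp (2 * (K * L)) :=
    Real.pow_div_factorial_le_exp _ (by positivity) _
  have h2 : (K * L) ^ (A * L) / ((A * L).factorial : ℝ) ≤
      Real.exp (2 * K) ^ L / (2 ^ A) ^ L := by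
    rw [le_div_iff₀ (by positivity), ← Real.exp_nat_mul, ← pow_mul]
    calc _ = (2 * (K * L)) ^ (A * L) / ((A * L).factorial : ℝ) := by rw [mul_pow]; ring
      _ ≤ _ := h1
      _ = _ := by congr 1; ring
  have h3 : (L : ℝ) ≤ 2 ^ L := by exact_mod_cast Nat.lt_two_pow_self.le
  calc n ^ d * (K * L * ((K * L) ^ (A * L) / ((A * L).factorial : ℝ)))
      ≤ (2 ^ L) ^ d * (K * 2 ^ L * (Real.exp (2 * K) ^ L / (2 ^ A) ^ L)) := by gcongr
    _ = K * (2 ^ (d + 1) * Real.exp (2 * K) / 2 ^ A) ^ L := by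
        rw [div_pow, mul_pow, ← pow_mul, ← pow_mul, mul_comm L d, ← pow_mul, add_mul, pow_add, one_mul]; ring
    _ ≤ _ := by
        refine mul_le_mul_of_nonneg_left (pow_le_pow_left₀ (by positivity) ?_ L) hK.le
        rw [div_le_div_iff₀ (by positivity) (by norm_num)]
        rw [pow_succ] at hA ⊢
        rw [pow_succ] at hA
        linarith

/-- Let `X^{(n)}` be an intensity-1 Poisson point process on the torus `T_n` with i.i.d.
marks of law `μR` with tail index `s = d` (`h^d P(R>h) → β`).  The process is encoded by
the multivariate Mecke formula (`hMecke`) for the number of descending chains of each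
length.  Then there is `c₁ > 0` such that with probability tending to `1` as `n → ∞`,
`X^{(n)}` contains no toroidal descending chain of more than `c₁ log n` elements. -/
theorem stmt9 {d : ℕ} (hd : 2 ≤ d) {β : ℝ} (hβ : 0 < β)
    {Ω : Type*} [MeasureSpace Ω] [IsProbabilityMeasure (volume : Measure Ω)]
    (μR : Measure ℝ) [IsProbabilityMeasure μR] (hμR : μR (Set.Iio 0) = 0)
    (htail : Tendsto (fun h : ℝ => h ^ d * (μR (Set.Ioi h)).toReal) atTop (𝓝 β))
    (X : ℕ → Ω → Finset (EuclideanSpace ℝ (Fin d) × ℝ))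
    (hloc : ∀ n ω, ∀ p ∈ X n ω, p.1 ∈ torCube d n ∧ 0 ≤ p.2)
    (hMecke : ∀ n m : ℕ, 1 ≤ m →
      (∫⁻ ω, ((Set.ncard {f : Fin m → EuclideanSpace ℝ (Fin d) × ℝ |
          (∀ i, f i ∈ X n ω) ∧ Function.Injective f ∧ isDescChain d (n : ℝ) f}) : ℝ≥0∞)) =
      (Measure.pi fun _ : Fin m =>
          (((volume : Measure (EuclideanSpace ℝ (Fin d))).restrict (torCube d n)).prod μR))
        {f | isDescChain d (n : ℝ) (fun i => f i)}) :
    ∃ c₁ : ℝ, 0 < c₁ ∧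
      Tendsto (fun n : ℕ =>
          (volume : Measure Ω) {ω | ∀ m : ℕ, c₁ * Real.log n < m →
            ¬∃ f : Fin m → EuclideanSpace ℝ (Fin d) × ℝ,
              (∀ i, f i ∈ X n ω) ∧ Function.Injective f ∧ isDescChain d (n : ℝ) f})
        atTop (𝓝 1) := by
  obtain ⟨K, hK, hKm⟩ := moment_bound μR htail
  obtain ⟨A, hA⟩ := final_bound d K hK
  have hl2 : 0 < Real.log 2 := Real.log_pos (by norm_num)
  refine ⟨2 * (A + 2) / Real.log 2, by positivity, ?_⟩
  have hlim : Tendsto (fun n : ℕ => 1 - ENNReal.ofReal (K * (1 / 2) ^ (Nat.log 2 n + 1)))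
      atTop (𝓝 1) := by
    have h0 : Tendsto (fun n : ℕ => Nat.log 2 n + 1) atTop atTop := by
      refine tendsto_atTop.2 fun b => ?_
      filter_upwards [eventually_ge_atTop (2 ^ b)] with n hn
      exact (Nat.le_log_of_pow_le (by norm_num) hn).trans (Nat.le_succ _)
    have h1 : Tendsto (fun L : ℕ => K * (1 / 2 : ℝ) ^ L) atTop (𝓝 (K * 0)) :=
      (tendsto_pow_atTop_nhds_zero_of_lt_one (by norm_num) (by norm_num)).const_mul K
    have h2 := (ENNReal.tendsto_ofReal (h1.comp h0))
    have h3 := ENNReal.Tendsto.sub (tendsto_const_nhds (x := (1 : ℝ≥0∞))) h2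
      (Or.inl ENNReal.one_ne_top)
    simpa using h3
  refine tendsto_of_tendsto_of_tendsto_of_le_of_le' hlim tendsto_const_nhds ?_
    (Eventually.of_forall fun n => prob_le_one)
  filter_upwards [eventually_ge_atTop 2] with n hn
  set L := Nat.log 2 n + 1 with hL
  set G := {ω | ∀ m : ℕ, 2 * (A + 2) / Real.log 2 * Real.log n < m →
            ¬∃ f : Fin m → EuclideanSpace ℝ (Fin d) × ℝ,
              (∀ i, f i ∈ X n ω) ∧ Function.Injective f ∧ isDescChain d (n : ℝ) f} with hG
  have hnL : (n : ℝ) ≤ 2 ^ L := by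
    exact_mod_cast (Nat.lt_pow_succ_log_self (by norm_num) n).le
  have hL1 : 1 ≤ L := by omega
  have hE := hMecke n (A * L + 2) (by omega)
  have hbound : (∫⁻ ω, ((Set.ncard {f : Fin (A * L + 2) → EuclideanSpace ℝ (Fin d) × ℝ |
          (∀ i, f i ∈ X n ω) ∧ Function.Injective f ∧ isDescChain d (n : ℝ) f}) : ℝ≥0∞)) ≤
      ENNReal.ofReal (K * (1 / 2) ^ L) := by
    rw [hE]
    exact (chain_measure_le d n μR hd (A * L) _ (hKm n L hL1 (by positivity) hnL)).trans
      (hA n L (by positivity) hnL)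
  -- length comparison
  have hlen : ((A * L + 2 : ℕ) : ℝ) ≤ 2 * (A + 2) / Real.log 2 * Real.log n := by
    have hn0 : n ≠ 0 := by omega
    have h1 : (2 : ℝ) ^ Nat.log 2 n ≤ n := by exact_mod_cast Nat.pow_log_le_self 2 hn0
    have h2 : (Nat.log 2 n : ℝ) * Real.log 2 ≤ Real.log n := by
      rw [← Real.log_pow]
      exact Real.log_le_log (by positivity) h1
    have h3 : Real.log 2 ≤ Real.log n := Real.log_le_log (by norm_num) (by exact_mod_cast hn)
    have h4 : (L : ℝ) * Real.log 2 ≤ 2 * Real.log n := by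
      rw [hL]; push_cast; linarith
    have h5 : (1 : ℝ) ≤ L := by exact_mod_cast hL1
    rw [div_mul_eq_mul_div, le_div_iff₀ hl2]
    push_cast
    calc ((A : ℝ) * L + 2) * Real.log 2 ≤ ((A + 2) * L) * Real.log 2 := by
          gcongr; nlinarith
      _ = (A + 2) * (L * Real.log 2) := by ring
      _ ≤ (A + 2) * (2 * Real.log n) := by gcongr
      _ = _ := by ring
  -- Markov
  have hmeas := measurableSet_toMeasurable (volume : Measure Ω) G
  have hc : (volume : Measure Ω) (toMeasurable volume G)ᶜ ≤ ENNReal.ofReal (K * (1 / 2) ^ L) := by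
    refine le_trans ?_ hbound
    rw [← lintegral_indicator_one hmeas.compl]
    apply lintegral_mono
    intro ω
    by_cases hω : ω ∈ (toMeasurable volume G)ᶜ
    · rw [Set.indicator_of_mem hω]
      have hω' : ω ∉ G := fun h => hω (subset_toMeasurable _ _ h)
      simp only [hG, Set.mem_setOf_eq, not_forall, not_not] at hω'
      obtain ⟨m, hm, f, hf1, hf2, hf3⟩ := hω'
      have hle : A * L + 2 ≤ m := by
        have := hlen.trans hm.le
        exact_mod_cast this
      have hfin : {f : Fin (A * L + 2) → EuclideanSpace ℝ (Fin d) × ℝ |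
          (∀ i, f i ∈ X n ω) ∧ Function.Injective f ∧ isDescChain d (n : ℝ) f}.Finite := by
        refine (Set.Finite.pi' (t := fun _ => (X n ω : Set (EuclideanSpace ℝ (Fin d) × ℝ)))
          fun _ => Finset.finite_toSet _).subset ?_
        intro g hg i
        exact hg.1 i
      have hne : 0 < Set.ncard {f : Fin (A * L + 2) → EuclideanSpace ℝ (Fin d) × ℝ |
          (∀ i, f i ∈ X n ω) ∧ Function.Injective f ∧ isDescChain d (n : ℝ) f} := by
        rw [Set.ncard_pos hfin]
        refine ⟨fun i => f (Fin.castLE hle i), fun i => hf1 _, ?_, isDescChain_init hle hf3⟩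
        exact hf2.comp (Fin.castLE_injective hle)
      simp only [Pi.one_apply]
      exact_mod_cast hne
    · rw [Set.indicator_of_notMem hω]
      exact zero_le
  rw [← measure_toMeasurable G, tsub_le_iff_right]
  calc (1 : ℝ≥0∞) = volume (toMeasurable volume G) + volume (toMeasurable volume G)ᶜ := by
        rw [measure_add_measure_compl hmeas, measure_univ]
    _ ≤ _ := by gcongr
end

section
/- The expected number of toroidal descending chains of m+1 points in an intensity-1 Poisson process on T_n, in which all marks are bounded above by t_0, is at most n^d (κ_d t_0^d)^m / m!. -/
open MeasureTheory
open scoped ENNReal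

/-- A strictly decreasing order of i.i.d. marks has probability at most `1 / k!`. -/
lemma strictAnti_bound (μ : Measure ℝ) [IsProbabilityMeasure μ] (k : ℕ) :
    (Measure.pi fun _ : Fin k => μ) {r | StrictAnti r} ≤ ((k.factorial : ℕ) : ℝ≥0∞)⁻¹ := by
  set P := Measure.pi fun _ : Fin k => μ with hP
  have hmeas : MeasurableSet {r : Fin k → ℝ | StrictAnti r} := by
    have : {r : Fin k → ℝ | StrictAnti r} = ⋂ i, ⋂ j, ⋂ (_ : i < j), {r | r j < r i} := by
      ext r
      simp only [Set.mem_ofPred_eq, Set.mem_iInter]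
      exact ⟨fun h i j hij => h hij, fun h i j hij => h i j hij⟩
    rw [this]
    refine MeasurableSet.iInter fun i => MeasurableSet.iInter fun j => MeasurableSet.iInter fun _ =>
      measurableSet_lt (measurable_pi_apply j) (measurable_pi_apply i)
  have hmp : ∀ σ : Equiv.Perm (Fin k), MeasurePreserving (fun r : Fin k → ℝ => r ∘ σ) P P := by
    intro σ
    have h := measurePreserving_piCongrLeft (fun _ : Fin k => μ) σ⁻¹
    have e : (fun r : Fin k → ℝ => r ∘ σ) =
        ⇑(MeasurableEquiv.piCongrLeft (fun _ : Fin k => ℝ) σ⁻¹) := by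
      funext r i
      have := Equiv.piCongrLeft_apply_apply (fun _ : Fin k => ℝ) σ⁻¹ r (σ i)
      rw [show σ⁻¹ (σ i) = i from σ.symm_apply_apply i] at this
      rw [MeasurableEquiv.coe_piCongrLeft, this]
      rfl
    rw [e]
    exact h
  have hm' : ∀ σ : Equiv.Perm (Fin k),
      MeasurableSet ((fun r : Fin k → ℝ => r ∘ σ) ⁻¹' {r | StrictAnti r}) :=
    fun σ => (hmp σ).measurable hmeas
  have hdisj : Pairwise (Function.onFun Disjoint fun σ : Equiv.Perm (Fin k) =>
      (fun r : Fin k → ℝ => r ∘ σ) ⁻¹' {r | StrictAnti r}) := by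
    intro σ τ hne
    refine Set.disjoint_left.2 fun r h1 h2 => hne ?_
    simp only [Set.mem_preimage, Set.mem_ofPred_eq] at h1 h2
    have hs : StrictMono (τ⁻¹ * σ) := by
      intro i j hij
      have := h1 hij
      rw [← h2.lt_iff_gt]
      simpa using this
    have e : hs.orderIsoOfSurjective _ (τ⁻¹ * σ).surjective = OrderIso.refl _ :=
      Subsingleton.elim _ _
    have e2 : τ⁻¹ * σ = 1 := by
      ext i
      have := congrArg (fun g : Fin k ≃o Fin k => g i) e
      simpa using congrArg Fin.val this
    exact (inv_mul_eq_one.1 e2).symm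
  have h1 : ∑ σ : Equiv.Perm (Fin k),
      P ((fun r : Fin k → ℝ => r ∘ σ) ⁻¹' {r | StrictAnti r}) ≤ 1 := by
    rw [← tsum_fintype (L := .unconditional _), ← measure_iUnion hdisj hm']
    exact prob_le_one
  have h2 : ∀ σ : Equiv.Perm (Fin k),
      P ((fun r : Fin k → ℝ => r ∘ σ) ⁻¹' {r | StrictAnti r}) = P {r | StrictAnti r} :=
    fun σ => (hmp σ).measure_preimage hmeas.nullMeasurableSet
  simp only [h2, Finset.sum_const, Finset.card_univ, Fintype.card_perm, Fintype.card_fin,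
    nsmul_eq_mul] at h1
  rw [mul_comm] at h1
  rw [← one_div]
  rw [ENNReal.le_div_iff_mul_le (Or.inl (by simp [Nat.factorial_ne_zero])) (Or.inl (by simp))]
  exact h1

/-- Volume of a set of chains with increments in `K`, in a group with an invariant measure. -/
lemma chain_group {G : Type*} [AddGroup G] [MeasurableSpace G] [MeasurableSub₂ G]
    [MeasurableAdd₂ G]
    (ν : Measure G) [IsFiniteMeasure ν] [ν.IsAddRightInvariant] {K : Set G}
    (hK : MeasurableSet K) (m : ℕ) :
    MeasurableSet {z : Fin (m + 1) → G | ∀ i : Fin m, z i.castSucc - z i.succ ∈ K} ∧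
    (Measure.pi fun _ : Fin (m + 1) => ν)
      {z | ∀ i : Fin m, z i.castSucc - z i.succ ∈ K} = ν Set.univ * ν K ^ m := by
  have hmeas : ∀ m : ℕ,
      MeasurableSet {z : Fin (m + 1) → G | ∀ i : Fin m, z i.castSucc - z i.succ ∈ K} := by
    intro m
    rw [Set.ofPred_forall]
    refine MeasurableSet.iInter fun i => ?_
    exact (((measurable_pi_apply i.castSucc).sub (measurable_pi_apply i.succ)) :
      Measurable fun z : Fin (m + 1) → G => z i.castSucc - z i.succ) hK
  refine ⟨hmeas m, ?_⟩
  induction m with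
  | zero => simp [Measure.pi_univ]
  | succ m ih =>
    have hmp := measurePreserving_piFinSuccAbove (fun _ : Fin (m + 2) => ν) 0
    set A : Set (Fin (m + 1) → G) := {z | ∀ i : Fin m, z i.castSucc - z i.succ ∈ K} with hA
    set S : Set (G × (Fin (m + 1) → G)) := {p | p.1 - p.2 0 ∈ K ∧ p.2 ∈ A} with hS
    have hSm : MeasurableSet S :=
      ((measurable_fst.sub ((measurable_pi_apply 0).comp measurable_snd)) hK).inter
        (measurable_snd (hmeas m))
    have e : {z : Fin (m + 1 + 1) → G | ∀ i : Fin (m + 1), z i.castSucc - z i.succ ∈ K} =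
        (MeasurableEquiv.piFinSuccAbove (fun _ : Fin (m + 2) => G) 0) ⁻¹' S := by
      ext z
      simp only [Set.mem_ofPred_eq, Set.mem_preimage, hS, hA, Fin.forall_fin_succ (n := m)]
      rfl
    rw [e, hmp.measure_preimage hSm.nullMeasurableSet, Measure.prod_apply_symm hSm]
    have h2 : ∀ y : Fin (m + 1) → G, ν ((fun x => (x, y)) ⁻¹' S) = A.indicator (fun _ => ν K) y := by
      intro y
      by_cases hy : y ∈ A
      · rw [Set.indicator_of_mem hy]
        have : (fun x => (x, y)) ⁻¹' S = (fun x => x + (- y 0)) ⁻¹' K := by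
          ext x
          simp [hS, hy, sub_eq_add_neg]
        rw [this, measure_preimage_add_right]
      · rw [Set.indicator_of_notMem hy]
        have : (fun x => (x, y)) ⁻¹' S = ∅ := by
          ext x
          simp [hS, hy]
        simp [this]
    simp only [h2]
    rw [lintegral_indicator (hmeas m)]
    simp only [lintegral_const, Measure.restrict_apply_univ]
    rw [ih, pow_succ]
    ring

/-- The quotient map from the Euclidean space to the flat torus. -/
noncomputable def torQ (d : ℕ) (n : ℝ) (x : EuclideanSpace ℝ (Fin d)) : Fin d → AddCircle n :=
  fun i => (x i : AddCircle n)

lemma torCube_eq_s10 (d : ℕ) (n : ℝ) : torCube d n =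
    (@WithLp.ofLp 2 (Fin d → ℝ)) ⁻¹' (Set.univ.pi fun _ => Set.Icc (-(n/2)) (n/2)) := by
  ext x
  simp only [torCube, Set.mem_preimage, Set.mem_pi, Set.mem_univ, true_implies, Set.mem_Icc,
    Set.mem_ofPred_eq, abs_le]

lemma torQ_mp (d : ℕ) (n : ℝ) [hn : Fact (0 < n)] :
    MeasurePreserving (torQ d n)
      ((volume : Measure (EuclideanSpace ℝ (Fin d))).restrict (torCube d n))
      (Measure.pi fun _ => (volume : Measure (AddCircle n))) := by
  have h1 := (PiLp.volume_preserving_ofLp (Fin d)).restrict_preimage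
    (s := Set.univ.pi fun _ => Set.Icc (-(n/2)) (n/2))
    (MeasurableSet.univ_pi fun _ => measurableSet_Icc)
  rw [← torCube_eq_s10, volume_pi, Measure.restrict_pi_pi] at h1
  have h2 : MeasurePreserving ((↑) : ℝ → AddCircle n)
      (volume.restrict (Set.Icc (-(n/2)) (n/2))) volume := by
    have := AddCircle.measurePreserving_mk n (-(n/2))
    rw [show -(n/2) + n = n/2 by ring, Measure.restrict_congr_set Ioc_ae_eq_Icc] at this
    exact this
  exact (measurePreserving_pi _ _ fun _ : Fin d => h2).comp h1

/-- The ball of radius `t` in the flat torus. -/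
def torK (d : ℕ) (n t : ℝ) : Set (Fin d → AddCircle n) := {z | ∑ i, ‖z i‖ ^ 2 ≤ t ^ 2}

lemma torK_meas (d : ℕ) (n t : ℝ) [Fact (0 < n)] : MeasurableSet (torK d n t) := by
  refine measurableSet_le (Finset.measurable_sum _ fun i _ => ?_) measurable_const
  exact ((measurable_pi_apply i).norm).pow_const 2

lemma torK_vol (d : ℕ) (n t : ℝ) [hn : Fact (0 < n)] (ht : 0 ≤ t) :
    (Measure.pi fun _ => (volume : Measure (AddCircle n))) (torK d n t) ≤
      ENNReal.ofReal (t ^ d) *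
        volume (Metric.closedBall (0 : EuclideanSpace ℝ (Fin d)) 1) := by
  rw [← (torQ_mp d n).measure_preimage (torK_meas d n t).nullMeasurableSet,
    Measure.restrict_apply ((torQ_mp d n).measurable (torK_meas d n t))]
  have hb := Measure.addHaar_closedBall' (volume : Measure (EuclideanSpace ℝ (Fin d))) 0 ht
  rw [finrank_euclideanSpace_fin] at hb
  rw [← hb]
  refine measure_mono ?_
  rintro x ⟨hx, hc⟩
  rw [mem_closedBall_zero_iff, EuclideanSpace.norm_eq]
  refine Real.sqrt_le_iff.2 ⟨ht, ?_⟩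
  have hx' : ∑ i, ‖(x i : AddCircle n)‖ ^ 2 ≤ t ^ 2 := hx
  refine le_trans (le_of_eq ?_) hx'
  refine Finset.sum_congr rfl fun i _ => ?_
  have h := (AddCircle.norm_coe_eq_abs_iff (x := x i) n hn.out.ne').2
    (by rw [abs_of_pos hn.out]; exact hc i)
  rw [h, Real.norm_eq_abs]

lemma norm_le_min (n u : ℝ) : ‖(u : AddCircle n)‖ ^ 2 ≤ (min |u| (n - |u|)) ^ 2 := by
  have key : ∀ v : ℝ, ‖(v : AddCircle n)‖ ≤ |v| := fun v => by
    have := QuotientAddGroup.norm_mk_le_norm (S := AddSubgroup.zmultiples n) (m := v)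
    exact this
  have k2 : ‖(u : AddCircle n)‖ ≤ abs (n - abs u) := by
    rcases abs_cases u with ⟨h, _⟩ | ⟨h, _⟩
    · rw [h, abs_sub_comm]
      have := key (u - n)
      simpa [AddCircle.coe_period] using this
    · rw [h]
      have := key (n - -u)
      simpa [AddCircle.coe_period] using this
  rcases min_choice |u| (n - |u|) with h | h <;> rw [h]
  · exact pow_le_pow_left₀ (norm_nonneg _) (key u) 2
  · rw [← sq_abs (n - |u|)]
    exact pow_le_pow_left₀ (norm_nonneg _) k2 2

lemma torQ_sub_mem {d : ℕ} {n t : ℝ} {x y : EuclideanSpace ℝ (Fin d)}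
    (h : torDist d n x y ≤ t) : torQ d n x - torQ d n y ∈ torK d n t := by
  have h1 := (Real.sqrt_le_iff.1 h).2
  refine le_trans (Finset.sum_le_sum fun i _ => ?_) h1
  have := norm_le_min n (x i - y i)
  simpa [torQ] using this

/-- The expected number of toroidal descending chains of `m+1` points of an intensity-1
marked Poisson point process on the torus `T_n` (mark law `μR`), in which all marks are
bounded above by `t₀`, is at most `n^d (κ_d t₀^d)^m / m!`.  The expectation of the chain
count is encoded through the multivariate Mecke formula (`hMecke`). -/
theorem stmt10 {d : ℕ} (hd : 2 ≤ d) {n : ℝ} (hn : 1 ≤ n) {m : ℕ} (hm : 1 ≤ m)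
    {t₀ : ℝ} (ht₀ : 0 < t₀)
    {Ω : Type*} [MeasureSpace Ω] [IsProbabilityMeasure (volume : Measure Ω)]
    (μR : Measure ℝ) [IsProbabilityMeasure μR] (hμR : μR (Set.Iio 0) = 0)
    (X : Ω → Finset (EuclideanSpace ℝ (Fin d) × ℝ))
    (hMecke :
      (∫⁻ ω, ((Set.ncard {f : Fin (m + 1) → EuclideanSpace ℝ (Fin d) × ℝ |
          (∀ i, f i ∈ X ω) ∧ Function.Injective f ∧ isDescChain d n f ∧
            ∀ i, (f i).2 ≤ t₀}) : ℝ≥0∞)) =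
      (Measure.pi fun _ : Fin (m + 1) =>
          (((volume : Measure (EuclideanSpace ℝ (Fin d))).restrict (torCube d n)).prod μR))
        {f | isDescChain d n (fun i => f i) ∧ ∀ i, (f i).2 ≤ t₀}) :
    (∫⁻ ω, ((Set.ncard {f : Fin (m + 1) → EuclideanSpace ℝ (Fin d) × ℝ |
        (∀ i, f i ∈ X ω) ∧ Function.Injective f ∧ isDescChain d n f ∧
          ∀ i, (f i).2 ≤ t₀}) : ℝ≥0∞)) ≤
      ENNReal.ofReal (n ^ d *
        ((volume (Metric.closedBall (0 : EuclideanSpace ℝ (Fin d)) 1)).toReal * t₀ ^ d) ^ m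
        / m.factorial) := by
  rw [hMecke]
  have hn0 : 0 < n := by linarith
  have : Fact (0 < n) := ⟨hn0⟩
  have hfin : IsFiniteMeasure
      ((volume : Measure (EuclideanSpace ℝ (Fin d))).restrict (torCube d n)) := by
    refine ⟨?_⟩
    rw [← Set.preimage_univ (f := torQ d n),
      (torQ_mp d n).measure_preimage MeasurableSet.univ.nullMeasurableSet]
    exact measure_lt_top _ _
  set μ := (volume : Measure (EuclideanSpace ℝ (Fin d))).restrict (torCube d n) with hμ
  set ν : Measure (Fin d → AddCircle n) := Measure.pi fun _ => volume with hν
  have hmp := measurePreserving_arrowProdEquivProdArrow (EuclideanSpace ℝ (Fin d)) ℝ (Fin (m + 1))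
    (fun _ => μ) (fun _ => μR)
  have hQ : MeasurePreserving (fun (x : Fin (m + 1) → EuclideanSpace ℝ (Fin d)) i => torQ d n (x i))
      (Measure.pi fun _ => μ) (Measure.pi fun _ => ν) :=
    measurePreserving_pi _ _ fun _ => torQ_mp d n
  obtain ⟨hAm, hA⟩ := chain_group ν (torK_meas d n t₀) m
  set A := {z : Fin (m + 1) → Fin d → AddCircle n |
    ∀ i : Fin m, z i.castSucc - z i.succ ∈ torK d n t₀} with hAdef
  set κ := volume (Metric.closedBall (0 : EuclideanSpace ℝ (Fin d)) 1) with hκ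
  have hκ' : κ ≠ ⊤ := measure_closedBall_lt_top.ne
  have hsub : {f : Fin (m + 1) → EuclideanSpace ℝ (Fin d) × ℝ |
      isDescChain d n (fun i => f i) ∧ ∀ i, (f i).2 ≤ t₀} ⊆
      (MeasurableEquiv.arrowProdEquivProdArrow (EuclideanSpace ℝ (Fin d)) ℝ (Fin (m + 1))) ⁻¹'
        (((fun x i => torQ d n (x i)) ⁻¹' A) ×ˢ {r | StrictAnti r}) := by
    rintro f ⟨⟨h1, h2⟩, h3⟩
    refine ⟨fun i => ?_, fun i j hij => h1 i j hij⟩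
    exact torQ_sub_mem ((h2 i (by omega)).trans (h3 _))
  have hνu : ν Set.univ = ENNReal.ofReal (n ^ d) := by
    rw [hν, Measure.pi_univ]
    simp [AddCircle.measure_univ, ENNReal.ofReal_pow hn0.le]
  calc _ ≤ _ := measure_mono hsub
    _ = (Measure.pi fun _ : Fin (m + 1) => ν) A *
        (Measure.pi fun _ : Fin (m + 1) => μR) {r | StrictAnti r} := by
      rw [hmp.measure_preimage_equiv, Measure.prod_prod,
        hQ.measure_preimage hAm.nullMeasurableSet]
    _ ≤ (ENNReal.ofReal (n ^ d) * (ENNReal.ofReal (t₀ ^ d) * κ) ^ m) *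
        ((m.factorial : ℕ) : ℝ≥0∞)⁻¹ := by
      rw [hA, hνu]
      refine mul_le_mul' (mul_le_mul' le_rfl (pow_le_pow_left' (torK_vol d n t₀ ht₀.le) m)) ?_
      refine (strictAnti_bound μR (m + 1)).trans (ENNReal.inv_le_inv.2 ?_)
      exact_mod_cast Nat.factorial_le (Nat.le_succ m)
    _ = _ := by
      have hf : (0 : ℝ) < m.factorial := by exact_mod_cast Nat.factorial_pos m
      rw [ENNReal.ofReal_div_of_pos hf, ENNReal.ofReal_mul (by positivity),
        ENNReal.ofReal_pow (p := _ * _) (by positivity), ENNReal.ofReal_mul ENNReal.toReal_nonneg,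
        ENNReal.ofReal_toReal hκ', ENNReal.ofReal_natCast, div_eq_mul_inv, mul_comm κ]
end
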